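/- arXiv:1903.05383 — 10 statements merged into one kernel-verified Lean document; each statement's English description precedes it below -/
import Mathlib

section
/- Let A ∈ ℝ^{n×n}, b ∈ ℝⁿ, positive reals ω₁,…,ω_N, a matrix Λ ∈ ℂ^{s×s} and a vector β ∈ ℝˢ. Set h₀ = b and for i = 1,…,N suppose K_i ∈ ℂ^{n×s} and 𝓗_i ∈ ℂ^{n×s} satisfy K_i = [A h_{i−1}, …, A h_{i−1}] + ω_i · A K_i Λᵀ and 𝓗_i = [h_{i−1}, …, h_{i−1}] + ω_i · K_i Λᵀ (so that K_i = A 𝓗_i), and set h_i = h_{i−1} + ω_i K_i β. Define P₀ = 0 and P_i = P_{i−1} + ω_i · 𝓗_i diag(β) 𝓗_iᴴ. Then for every j = 1,…,N: A P_j + P_j Aᵀ + b bᵀ = h_j h_jᴴ + Σ_{i=1}^{j} ω_i² · K_i ( diag(β)·conj(Λ) + Λᵀ·diag(β) − β βᵀ ) K_iᴴ. -/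
open Matrix

/-- One Runge-Kutta step increases `A P + P Aᴴ - h hᴴ` by the correction term of that step. -/
theorem lyapunov_residual_step {R n s : Type*} [CommRing R] [StarRing R]
    [Fintype n] [Fintype s] [DecidableEq s]
    (A : Matrix n n R) {w : R} (hw : star w = w) (Λ : Matrix s s R) {β : s → R}
    (hβ : star β = β) (h : n → R) {K H : Matrix n s R} (hKH : K = A * H)
    (hH : H = vecMulVec h 1 + w • (K * Λᵀ)) :
    A * (w • (H * diagonal β * Hᴴ)) + (w • (H * diagonal β * Hᴴ)) * Aᴴ
        + vecMulVec h (star h)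
      = vecMulVec (h + w • (K *ᵥ β)) (star (h + w • (K *ᵥ β)))
        + w ^ 2 • (K * (diagonal β * Λ.map (starRingEnd R) + Λᵀ * diagonal β
            - vecMulVec β β) * Kᴴ) := by
  have hΛ : Λᵀᴴ = Λ.map (starRingEnd R) := rfl
  have hHH : Hᴴ = vecMulVec 1 (star h) + w • (Λ.map (starRingEnd R) * Kᴴ) := by
    rw [hH, conjTranspose_add, conjTranspose_smul, conjTranspose_mul, hΛ, hw,
      conjTranspose_vecMulVec, star_one]
  have hD1 : diagonal β *ᵥ 1 = β := by ext i; simp [mulVec_diagonal]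
  have h1D : 1 ᵥ* diagonal β = β := by ext i; simp [vecMul_diagonal]
  have hL : A * (w • (H * diagonal β * Hᴴ)) = w • (K * diagonal β * Hᴴ) := by
    rw [hKH]; simp only [Matrix.mul_smul, Matrix.mul_assoc]
  have hR : (w • (H * diagonal β * Hᴴ)) * Aᴴ = w • (H * diagonal β * Kᴴ) := by
    rw [hKH, conjTranspose_mul]; simp only [Matrix.smul_mul, Matrix.mul_assoc]
  have hKβ : star (K *ᵥ β) = β ᵥ* Kᴴ := by rw [star_mulVec, hβ]
  rw [hL, hR, hHH, star_add, star_smul, hw, hKβ]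
  nth_rewrite 1 [hH]
  simp only [Matrix.mul_add, Matrix.add_mul, Matrix.mul_sub, Matrix.sub_mul, Matrix.mul_smul,
    Matrix.smul_mul, mul_vecMulVec, vecMulVec_mul, add_vecMulVec, vecMulVec_add, smul_vecMulVec,
    vecMulVec_smul, ← mulVec_mulVec, hD1, h1D, smul_add, smul_sub, smul_smul,
    Matrix.mul_assoc, pow_two]
  abel

/-- after `j` Runge-Kutta steps the Lyapunov residual of `P j`
equals `h j (h j)ᴴ` plus a sum of correction terms involving
`diag(β) conj(Λ) + Λᵀ diag(β) − β βᵀ`. -/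
theorem lyapunov_residual_after_RK_steps
    {n s N : ℕ} (A : Matrix (Fin n) (Fin n) ℝ) (b : Fin n → ℝ)
    (ω : ℕ → ℝ) (hω : ∀ i, 1 ≤ i → i ≤ N → 0 < ω i)
    (Λ : Matrix (Fin s) (Fin s) ℂ) (β : Fin s → ℝ)
    (A' : Matrix (Fin n) (Fin n) ℂ) (hA' : A' = A.map Complex.ofReal)
    (b' : Fin n → ℂ) (hb' : b' = fun i => (b i : ℂ))
    (β' : Fin s → ℂ) (hβ' : β' = fun j => (β j : ℂ))
    (h : ℕ → Fin n → ℂ) (K 𝓗 : ℕ → Matrix (Fin n) (Fin s) ℂ)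
    (P : ℕ → Matrix (Fin n) (Fin n) ℂ)
    (hh0 : h 0 = b')
    (hK : ∀ i, i < N →
      K (i+1) = (Matrix.of fun p (_ : Fin s) => (A' *ᵥ h i) p)
        + (ω (i+1) : ℂ) • (A' * K (i+1) * Λᵀ))
    (h𝓗 : ∀ i, i < N →
      𝓗 (i+1) = (Matrix.of fun p (_ : Fin s) => h i p)
        + (ω (i+1) : ℂ) • (K (i+1) * Λᵀ))
    (hhs : ∀ i, i < N → h (i+1) = h i + (ω (i+1) : ℂ) • (K (i+1) *ᵥ β'))
    (hP0 : P 0 = 0)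
    (hPs : ∀ i, i < N →
      P (i+1) = P i + (ω (i+1) : ℂ) • (𝓗 (i+1) * Matrix.diagonal β' * (𝓗 (i+1))ᴴ)) :
    ∀ j, 1 ≤ j → j ≤ N →
      A' * P j + P j * A'ᵀ + vecMulVec b' b'
        = vecMulVec (h j) (star (h j))
          + ∑ i ∈ Finset.Icc 1 j, ((ω i : ℂ)^2) •
              (K i * (Matrix.diagonal β' * Λ.map (starRingEnd ℂ)
                + Λᵀ * Matrix.diagonal β' - vecMulVec β' β') * (K i)ᴴ) := by
  have hAt : A'ᵀ = A'ᴴ := by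
    ext i j
    simp [hA']
  have hβ : star β' = β' := by
    ext i
    simp [hβ']
  have hb : star b' = b' := by
    ext i
    simp [hb']
  intro j hj1 hj
  clear hj1
  induction j with
  | zero => simp [hP0, hh0, hb]
  | succ k ih =>
    have hk : k < N := hj
    have hvec : (of fun p (_ : Fin s) => h k p) = vecMulVec (h k) 1 := by
      ext
      simp [vecMulVec_apply]
    have hAvec : (of fun p (_ : Fin s) => (A' *ᵥ h k) p) = vecMulVec (A' *ᵥ h k) 1 := by
      ext
      simp [vecMulVec_apply]
    have hH := h𝓗 k hk
    rw [hvec] at hH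
    have hKH : K (k + 1) = A' * 𝓗 (k + 1) := by
      rw [hH, Matrix.mul_add, mul_vecMulVec, Matrix.mul_smul, ← Matrix.mul_assoc, ← hAvec]
      exact hK k hk
    have step := lyapunov_residual_step A' (Complex.conj_ofReal (ω (k + 1))) Λ hβ (h k) hKH hH
    have ih' := ih hk.le
    rw [hAt] at ih' ⊢
    rw [hPs k hk, hhs k hk, Finset.sum_Icc_succ_top (by omega), ← add_assoc, add_right_comm (vecMulVec _ _),
      ← step, Matrix.mul_add, Matrix.add_mul, add_assoc _ (vecMulVec (h k) _), ← ih']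
    abel
end

section
/- Let A ∈ ℝ^{n×n}, b ∈ ℝⁿ, positive reals ω₁,…,ω_N, a matrix Λ ∈ ℂ^{s×s} and a vector β ∈ ℝˢ satisfying diag(β)·conj(Λ) + Λᵀ·diag(β) = β βᵀ. Set h₀ = b and for i = 1,…,N suppose K_i ∈ ℂ^{n×s} and 𝓗_i ∈ ℂ^{n×s} satisfy K_i = [A h_{i−1}, …, A h_{i−1}] + ω_i · A K_i Λᵀ and 𝓗_i = [h_{i−1}, …, h_{i−1}] + ω_i · K_i Λᵀ, and set h_i = h_{i−1} + ω_i K_i β, P₀ = 0, P_i = P_{i−1} + ω_i · 𝓗_i diag(β) 𝓗_iᴴ. Then every iterate satisfies the rank-one residual invariant A P_j + P_j Aᵀ + b bᵀ = h_j h_jᴴ for j = 1,…,N. -/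
open Matrix

/-- One step of the method raises the Lyapunov residual by exactly the change of the rank-one
term `h hᴴ`. -/
theorem lyapunov_step_increment {R m k : Type*} [CommRing R] [StarRing R]
    [Fintype m] [Fintype k] [DecidableEq k]
    {A : Matrix m m R} {M : Matrix k k R} {β : k → R} {ω : R} {h : m → R} {K H : Matrix m k R}
    (hβ : star β = β) (hω : star ω = ω)
    (hM : diagonal β * M.map star + Mᵀ * diagonal β = vecMulVec β β)
    (hK : K = A * H) (hH : H = vecMulVec h 1 + ω • (K * Mᵀ)) :
    A * (ω • (H * diagonal β * Hᴴ)) + (ω • (H * diagonal β * Hᴴ)) * Aᴴ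
        + vecMulVec h (star h)
      = vecMulVec (h + ω • (K *ᵥ β)) (star (h + ω • (K *ᵥ β))) := by
  have hHs : Hᴴ = vecMulVec 1 (star h) + ω • (M.map star * Kᴴ) := by
    conv_lhs => rw [hH]
    ext i j
    simp [conjTranspose_apply, mul_apply, hω, mul_comm]
  have hd : diagonal β *ᵥ 1 = β := by
    ext i
    simp [mulVec_diagonal]
  have hd' : 1 ᵥ* diagonal β = β := by
    ext i
    simp [vecMul_diagonal]
  have hKs : β ᵥ* Kᴴ = star (K *ᵥ β) := by
    rw [star_mulVec, hβ]
  have hleft : K * diagonal β * Hᴴ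
      = vecMulVec (K *ᵥ β) (star h) + ω • (K * (diagonal β * M.map star) * Kᴴ) := by
    rw [hHs, Matrix.mul_add, mul_vecMulVec, ← mulVec_mulVec, hd, Matrix.mul_smul]
    simp only [Matrix.mul_assoc]
  have hright : H * diagonal β * Kᴴ
      = vecMulVec h (star (K *ᵥ β)) + ω • (K * (Mᵀ * diagonal β) * Kᴴ) := by
    rw [hH, Matrix.add_mul, Matrix.add_mul, vecMulVec_mul, vecMulVec_mul, hd', hKs,
      Matrix.smul_mul, Matrix.smul_mul]
    simp only [Matrix.mul_assoc]
  have hsum : K * (diagonal β * M.map star) * Kᴴ + K * (Mᵀ * diagonal β) * Kᴴ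
      = vecMulVec (K *ᵥ β) (star (K *ᵥ β)) := by
    rw [← Matrix.add_mul, ← Matrix.mul_add, hM, mul_vecMulVec, vecMulVec_mul, hKs]
  have hAl : A * (H * diagonal β * Hᴴ) = K * diagonal β * Hᴴ := by
    simp only [hK, Matrix.mul_assoc]
  have hAr : H * diagonal β * Hᴴ * Aᴴ = H * diagonal β * Kᴴ := by
    simp only [hK, conjTranspose_mul, Matrix.mul_assoc]
  rw [Matrix.mul_smul, Matrix.smul_mul, hAl, hAr, hleft, hright, star_add, star_smul, hω,
    add_vecMulVec, vecMulVec_add, vecMulVec_add, smul_vecMulVec, vecMulVec_smul,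
    smul_vecMulVec, vecMulVec_smul, ← hsum]
  module

/-- if the Butcher tableau satisfies
`diag(β) conj(Λ) + Λᵀ diag(β) = β βᵀ`, then every Runge-Kutta iterate satisfies
the rank-one residual invariant `A P_j + P_j Aᵀ + b bᵀ = h_j h_jᴴ`. -/
theorem lyapunov_rank_one_residual_invariant
    {n s N : ℕ} (A : Matrix (Fin n) (Fin n) ℝ) (b : Fin n → ℝ)
    (ω : ℕ → ℝ) (hω : ∀ i, 1 ≤ i → i ≤ N → 0 < ω i)
    (Λ : Matrix (Fin s) (Fin s) ℂ) (β : Fin s → ℝ)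
    (A' : Matrix (Fin n) (Fin n) ℂ) (hA' : A' = A.map Complex.ofReal)
    (b' : Fin n → ℂ) (hb' : b' = fun i => (b i : ℂ))
    (β' : Fin s → ℂ) (hβ' : β' = fun j => (β j : ℂ))
    (hM : Matrix.diagonal β' * Λ.map (starRingEnd ℂ)
        + Λᵀ * Matrix.diagonal β' = vecMulVec β' β')
    (h : ℕ → Fin n → ℂ) (K 𝓗 : ℕ → Matrix (Fin n) (Fin s) ℂ)
    (P : ℕ → Matrix (Fin n) (Fin n) ℂ)
    (hh0 : h 0 = b')
    (hK : ∀ i, i < N →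
      K (i+1) = (Matrix.of fun p (_ : Fin s) => (A' *ᵥ h i) p)
        + (ω (i+1) : ℂ) • (A' * K (i+1) * Λᵀ))
    (h𝓗 : ∀ i, i < N →
      𝓗 (i+1) = (Matrix.of fun p (_ : Fin s) => h i p)
        + (ω (i+1) : ℂ) • (K (i+1) * Λᵀ))
    (hhs : ∀ i, i < N → h (i+1) = h i + (ω (i+1) : ℂ) • (K (i+1) *ᵥ β'))
    (hP0 : P 0 = 0)
    (hPs : ∀ i, i < N →
      P (i+1) = P i + (ω (i+1) : ℂ) • (𝓗 (i+1) * Matrix.diagonal β' * (𝓗 (i+1))ᴴ)) :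
    ∀ j, 1 ≤ j → j ≤ N →
      A' * P j + P j * A'ᵀ + vecMulVec b' b' = vecMulVec (h j) (star (h j)) := by
  have hA : A'ᵀ = A'ᴴ := by
    subst hA'
    ext i j
    simp
  have hβ : star β' = β' := by
    subst hβ'
    ext i
    simp
  have hb : star b' = b' := by
    subst hb'
    ext i
    simp
  suffices key : ∀ j, j ≤ N →
      A' * P j + P j * A'ᵀ + vecMulVec b' b' = vecMulVec (h j) (star (h j)) from
    fun j _ hj => key j hj
  intro j hj
  induction j with
  | zero => simp [hP0, hh0, hb]
  | succ i ih =>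
    have hi : i < N := hj
    have hof (v : Fin n → ℂ) :
        (Matrix.of fun p (_ : Fin s) => v p) = vecMulVec v 1 := by
      ext p q
      simp [vecMulVec_apply]
    have hH := h𝓗 i hi
    rw [hof] at hH
    have hKH : K (i + 1) = A' * 𝓗 (i + 1) := by
      rw [hH, Matrix.mul_add, mul_vecMulVec, Matrix.mul_smul, ← Matrix.mul_assoc, ← hof]
      exact hK i hi
    have hstep := lyapunov_step_increment hβ (Complex.conj_ofReal (ω (i + 1))) hM hKH hH
    have hprev : A' * P i + P i * A'ᵀ + vecMulVec b' b' = vecMulVec (h i) (star (h i)) :=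
      ih hi.le
    rw [hPs i hi, hhs i hi, ← hstep, ← hprev, hA, Matrix.mul_add, Matrix.add_mul]
    abel
end

section
/- Let μ₁,…,μ_s ∈ ℂ and define the DIRK Butcher tableau Λ ∈ ℂ^{s×s} by Λ_{ii} = μ_i, Λ_{ik} = 2·Re(μ_k) for k < i, and Λ_{ik} = 0 for k > i, together with β ∈ ℝˢ given by β_i = 2·Re(μ_i). Then diag(β)·conj(Λ) + Λᵀ·diag(β) = β βᵀ. -/
open Matrix

/-- the DIRK tableau with diagonal entries `μ i`, strictly lower
triangular entries `2 Re(μ k)` and weights `β i = 2 Re(μ i)` satisfies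
`diag(β) conj(Λ) + Λᵀ diag(β) = β βᵀ`. -/
theorem dirk_tableau_satisfies_famous_m
    {s : ℕ} (μ : Fin s → ℂ)
    (Λ : Matrix (Fin s) (Fin s) ℂ)
    (hΛ : ∀ i k : Fin s, Λ i k =
      if i = k then μ i else if k < i then 2 * ((μ k).re : ℂ) else 0)
    (β : Fin s → ℝ) (hβ : ∀ i, β i = 2 * (μ i).re)
    (β' : Fin s → ℂ) (hβ' : β' = fun i => (β i : ℂ)) :
    Matrix.diagonal β' * Λ.map (starRingEnd ℂ)
      + Λᵀ * Matrix.diagonal β' = vecMulVec β' β' := by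
  subst hβ'
  ext i k
  simp only [Matrix.add_apply, diagonal_mul, mul_diagonal, map_apply, transpose_apply,
    vecMulVec_apply, hΛ, hβ]
  rcases lt_trichotomy i k with h | rfl | h
  · simp [h.ne, h.ne', h, h.not_gt]
  · have key := Complex.add_conj (μ i)
    simp only [if_true]
    push_cast at key ⊢
    linear_combination 2 * ((μ i).re : ℂ) * key
  · simp [h.ne, h.ne', h, h.not_gt, Complex.conj_ofNat]
end

section
/- Let A ∈ ℂ^{n×n}, h₀ ∈ ℂⁿ and μ₁,…,μ_s ∈ ℂ. Suppose K₁,…,K_s ∈ ℂⁿ satisfy (I − μ_i A)·K_i = A·h_{i−1} where h_i = h_{i−1} + 2·Re(μ_i)·K_i for i = 1,…,s. Let Λ ∈ ℂ^{s×s} be the DIRK matrix with Λ_{ii} = μ_i, Λ_{ik} = 2·Re(μ_k) for k < i, Λ_{ik} = 0 for k > i, and let β ∈ ℂˢ have entries β_i = 2·Re(μ_i). Then the n×s matrix K = [K₁,…,K_s] satisfies K = [A h₀, …, A h₀] + A·K·Λᵀ, and h_s = h₀ + K·β. (In other words, s steps with the 1-stage tableaus (μ_i, 2Re(μ_i)) coincide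 with one step of the s-stage DIRK method.) -/
open Matrix

/-- A sequence with prescribed increments `d i` is its initial value plus the partial sums
of the increments. -/
theorem eq_add_sum_of_forall_succ_eq_add {M : Type*} [AddCommMonoid M] {s : ℕ}
    (h : ℕ → M) (d : Fin s → M) (hd : ∀ i : Fin s, h (i.val + 1) = h i.val + d i)
    {m : ℕ} (hm : m ≤ s) :
    h m = h 0 + ∑ k : Fin s, if k.val < m then d k else 0 := by
  induction m with
  | zero => simp
  | succ m ih =>
    have hsplit : ∀ k : Fin s, (if k.val < m + 1 then d k else 0) =
        (if k.val < m then d k else 0) + if k = ⟨m, hm⟩ then d k else 0 := by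
      intro k
      rcases lt_trichotomy k.val m with hk | hk | hk
      · simp [hk, hk.ne, Fin.ext_iff, Nat.lt_succ_of_lt hk]
      · simp [hk, Fin.ext_iff]
      · simp [Fin.ext_iff, hk.ne', not_lt.2 hk.le, Nat.not_le.2 hk]
    rw [hd ⟨m, hm⟩, ih (Nat.le_of_succ_le hm), Finset.sum_congr rfl fun k _ => hsplit k,
      Finset.sum_add_distrib, Finset.sum_ite_eq' Finset.univ, if_pos (Finset.mem_univ _),
      add_assoc]

/-- `s` steps with the 1-stage tableaus `(μ i, 2 Re μ i)` coincide
with one step of the `s`-stage DIRK method: the matrix `K = [K₁,…,K_s]`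
satisfies `K = [A h₀,…,A h₀] + A K Λᵀ` and `h_s = h₀ + K β`. -/
theorem one_stage_steps_equal_dirk_step
    {n s : ℕ} (A : Matrix (Fin n) (Fin n) ℂ) (h₀ : Fin n → ℂ)
    (μ : Fin s → ℂ) (K : Fin s → Fin n → ℂ) (h : ℕ → Fin n → ℂ)
    (hh0 : h 0 = h₀)
    (hK : ∀ i : Fin s, (1 - μ i • A) *ᵥ K i = A *ᵥ h i.val)
    (hh : ∀ i : Fin s, h (i.val + 1) = h i.val + (2 * (μ i).re : ℂ) • K i)
    (Λ : Matrix (Fin s) (Fin s) ℂ)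
    (hΛ : ∀ i k : Fin s, Λ i k =
      if i = k then μ i else if k < i then 2 * ((μ k).re : ℂ) else 0)
    (β : Fin s → ℂ) (hβ : ∀ i, β i = 2 * ((μ i).re : ℂ))
    (Kmat : Matrix (Fin n) (Fin s) ℂ) (hKmat : Kmat = Matrix.of fun p q => K q p) :
    Kmat = (Matrix.of fun p (_ : Fin s) => (A *ᵥ h₀) p) + A * Kmat * Λᵀ ∧
      h s = h₀ + Kmat *ᵥ β := by
  subst hKmat hh0
  have hsum : ∀ m ≤ s, h m = h 0 +
      ∑ k : Fin s, if k.val < m then (2 * (μ k).re : ℂ) • K k else 0 :=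
    fun m hm => eq_add_sum_of_forall_succ_eq_add h _ hh hm
  have hmulVec : ∀ v : Fin s → ℂ,
      (Matrix.of fun p q => K q p) *ᵥ v = ∑ k, v k • K k := by
    intro v
    ext p
    simp [Matrix.mulVec, dotProduct, Finset.sum_apply, mul_comm]
  constructor
  · have hstage : ∀ q, h 0 + ∑ k, Λ q k • K k = h q.val + μ q • K q := by
      intro q
      have hsplit : ∀ k, Λ q k • K k =
          (if k.val < q.val then (2 * (μ k).re : ℂ) • K k else 0) +
            if k = q then μ k • K k else 0 := by
        intro k
        rw [hΛ]
        by_cases hk : q = k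
        · subst hk
          simp
        · simp [hk, Ne.symm hk, ite_smul]
      rw [Finset.sum_congr rfl fun k _ => hsplit k, Finset.sum_add_distrib,
        Finset.sum_ite_eq' Finset.univ, if_pos (Finset.mem_univ _), ← add_assoc,
        ← hsum q.val q.isLt.le]
    have hcol : ∀ q, K q = A *ᵥ h 0 + A *ᵥ ((Matrix.of fun p q => K q p) *ᵥ Λ q) := by
      intro q
      have hq := hK q
      rw [Matrix.sub_mulVec, Matrix.one_mulVec, Matrix.smul_mulVec, sub_eq_iff_eq_add] at hq
      rw [hmulVec, ← Matrix.mulVec_add, hstage, Matrix.mulVec_add, Matrix.mulVec_smul]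
      exact hq
    ext p q
    have hpq := congrFun (hcol q) p
    rw [Matrix.mulVec_mulVec] at hpq
    exact hpq
  · rw [hmulVec, hsum s le_rfl]
    simp [hβ]
end

section
/- Let Λ ∈ ℂ^{s×s} and β ∈ ℝˢ with β_j > 0 for all j, satisfying diag(β)·conj(Λ) + Λᵀ·diag(β) = β βᵀ. Then −conj(Λ) = diag(β)^{-1}·(Λᵀ − β·𝟙_sᵀ)·diag(β); consequently −conj(Λ) is similar to Λ − 𝟙_s·βᵀ, and in particular the matrices −conj(Λ) and Λ − 𝟙_s·βᵀ have the same characteristic polynomial. -/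
open Matrix

/-- Some unimodular number rotates a given complex number onto the real line. -/
lemma Complex.exists_norm_one_mul_real (z : ℂ) :
    ∃ p : ℂ, star p * p = 1 ∧ star (star p * z) = star p * z := by
  by_cases hz : z = 0
  · exact ⟨1, by simp, by simp [hz]⟩
  · have hn : (‖z‖ : ℂ) ≠ 0 := by simpa using hz
    have hc : star z * z = (‖z‖ : ℂ) ^ 2 := by
      simpa using Complex.conj_mul' z
    refine ⟨z / ‖z‖, ?_, ?_⟩
    · simp only [star_div₀, RCLike.star_def, Complex.conj_ofReal] at hc ⊢
      field_simp
      exact hc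
    · simp only [star_mul', star_div₀, RCLike.star_def, Complex.conj_ofReal,
        Complex.conj_conj]
      ring

/-- A complex matrix whose Hermitian part is a multiple of `b bᴴ` is unitarily similar to a
symmetric matrix. -/
lemma Matrix.exists_unitary_isSymm {n : Type*} [Fintype n] [DecidableEq n]
    (M : Matrix n n ℂ) (a : ℂ) (b : n → ℂ) (hM : M + Mᴴ = a • vecMulVec b (star b)) :
    ∃ W : Matrix n n ℂ, Wᴴ * W = 1 ∧ (Wᴴ * M * W).IsSymm := by
  have hH : (Complex.I • (M - Mᴴ)).IsHermitian := by
    rw [Matrix.IsHermitian, conjTranspose_smul, conjTranspose_sub, conjTranspose_conjTranspose,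
      RCLike.star_def, Complex.conj_I, neg_smul, ← smul_neg, neg_sub]
  obtain ⟨U, d, hU, hd⟩ : ∃ (U : Matrix n n ℂ) (d : n → ℂ), Uᴴ * U = 1 ∧
      Uᴴ * (Complex.I • (M - Mᴴ)) * U = diagonal d := by
    refine ⟨hH.eigenvectorUnitary, RCLike.ofReal ∘ hH.eigenvalues,
      Unitary.coe_star_mul_self hH.eigenvectorUnitary, ?_⟩
    have := hH.conjStarAlgAut_star_eigenvectorUnitary
    rw [Unitary.conjStarAlgAut_star_apply] at this
    exact this
  choose p hp hpr using fun j => Complex.exists_norm_one_mul_real ((Uᴴ *ᵥ b) j)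
  have hP : (diagonal p)ᴴ * diagonal p = 1 := by
    rw [diagonal_conjTranspose, diagonal_mul_diagonal, ← diagonal_one]
    exact congrArg _ (funext hp)
  set W := U * diagonal p with hW
  have hWd : Wᴴ * (Complex.I • (M - Mᴴ)) * W = diagonal d := by
    calc Wᴴ * (Complex.I • (M - Mᴴ)) * W
        = (diagonal p)ᴴ * (Uᴴ * (Complex.I • (M - Mᴴ)) * U) * diagonal p := by
          simp only [hW, conjTranspose_mul, Matrix.mul_assoc]
      _ = diagonal d * ((diagonal p)ᴴ * diagonal p) := by
          rw [hd, diagonal_conjTranspose, ← Matrix.mul_assoc,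
            (commute_diagonal (star p) d).eq]
      _ = diagonal d := by rw [hP, Matrix.mul_one]
  have hWb : star (Wᴴ *ᵥ b) = Wᴴ *ᵥ b := by
    funext j
    rw [hW, conjTranspose_mul, ← mulVec_mulVec, diagonal_conjTranspose, Pi.star_apply,
      mulVec_diagonal]
    exact hpr j
  have hWv : Wᴴ * (M + Mᴴ) * W = a • vecMulVec (Wᴴ *ᵥ b) (Wᴴ *ᵥ b) := by
    rw [hM, Matrix.mul_smul, Matrix.smul_mul, mul_vecMulVec, vecMulVec_mul]
    congr 2
    rw [← hWb, star_mulVec, conjTranspose_conjTranspose]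
  have hdec : M = (1 / 2 : ℂ) • (M + Mᴴ) - (Complex.I / 2) • (Complex.I • (M - Mᴴ)) := by
    ext i j
    simp only [Matrix.sub_apply, Matrix.smul_apply, Matrix.add_apply, smul_eq_mul]
    linear_combination (M i j - Mᴴ i j) / 2 * Complex.I_mul_I
  refine ⟨W, ?_, ?_⟩
  · rw [hW, conjTranspose_mul, Matrix.mul_assoc, ← Matrix.mul_assoc Uᴴ, hU, Matrix.one_mul, hP]
  · rw [hdec, Matrix.mul_sub, Matrix.sub_mul, Matrix.mul_smul, Matrix.mul_smul _ (Complex.I / 2),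
      Matrix.smul_mul, Matrix.smul_mul, hWd, hWv, Matrix.IsSymm]
    simp only [transpose_sub, transpose_smul, transpose_vecMulVec, diagonal_transpose]

/-- A matrix similar to a symmetric matrix is similar to its transpose. -/
lemma Matrix.transpose_eq_of_isSymm_conj {n R : Type*} [Fintype n] [DecidableEq n] [CommRing R]
    {M V W : Matrix n n R} (hVW : V * W = 1) (hS : (V * M * W).IsSymm) :
    Mᵀ = (W * Wᵀ)⁻¹ * M * (W * Wᵀ) := by
  have hWV : W * V = 1 := mul_eq_one_comm.mp hVW
  have hinv : (W * Wᵀ)⁻¹ = Vᵀ * V := by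
    refine inv_eq_left_inv ?_
    rw [Matrix.mul_assoc, ← Matrix.mul_assoc V, hVW, Matrix.one_mul, ← transpose_mul, hWV,
      transpose_one]
  have hT : Wᵀ * Mᵀ * Vᵀ = V * M * W := by
    rw [← hS.eq]
    simp only [transpose_mul, Matrix.mul_assoc]
  calc Mᵀ = (W * V)ᵀ * Mᵀ * (W * V)ᵀ := by simp [hWV]
    _ = Vᵀ * (Wᵀ * Mᵀ * Vᵀ) * Wᵀ := by simp only [transpose_mul, Matrix.mul_assoc]
    _ = (W * Wᵀ)⁻¹ * M * (W * Wᵀ) := by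
      rw [hT, hinv]
      simp only [Matrix.mul_assoc]

/-- if `diag(β) conj(Λ) + Λᵀ diag(β) = β βᵀ` with positive weights
`β`, then `−conj(Λ) = diag(β)⁻¹ (Λᵀ − β 𝟙ᵀ) diag(β)`; consequently `−conj(Λ)` is
similar to `Λ − 𝟙 βᵀ`, and both have the same characteristic polynomial. -/
theorem famous_m_similarity
    {s : ℕ} (Λ : Matrix (Fin s) (Fin s) ℂ) (β : Fin s → ℝ)
    (hβpos : ∀ j, 0 < β j)
    (β' : Fin s → ℂ) (hβ' : β' = fun j => (β j : ℂ))
    (hM : Matrix.diagonal β' * Λ.map (starRingEnd ℂ)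
        + Λᵀ * Matrix.diagonal β' = vecMulVec β' β') :
    -(Λ.map (starRingEnd ℂ))
        = (Matrix.diagonal β')⁻¹
          * (Λᵀ - vecMulVec β' (fun _ : Fin s => (1:ℂ))) * Matrix.diagonal β' ∧
      (∃ T : Matrix (Fin s) (Fin s) ℂ, IsUnit T ∧
        -(Λ.map (starRingEnd ℂ))
          = T⁻¹ * (Λ - vecMulVec (fun _ : Fin s => (1:ℂ)) β') * T) ∧
      (-(Λ.map (starRingEnd ℂ))).charpoly
        = (Λ - vecMulVec (fun _ : Fin s => (1:ℂ)) β').charpoly := by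
  have hβ0 : ∀ j, β' j ≠ 0 := fun j => by
    rw [hβ']
    exact Complex.ofReal_ne_zero.mpr (hβpos j).ne'
  have hD : IsUnit (diagonal β') := by
    rw [isUnit_diagonal, Pi.isUnit_iff]
    exact fun j => (hβ0 j).isUnit
  have hDdet : IsUnit (diagonal β').det := (isUnit_iff_isUnit_det _).mp hD
  set A := Λ - vecMulVec (fun _ : Fin s => (1 : ℂ)) β' with hA
  have hAT : Λᵀ - vecMulVec β' (fun _ : Fin s => (1 : ℂ)) = Aᵀ := by
    rw [hA, transpose_sub, transpose_vecMulVec]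
  have hfirst : -(Λ.map (starRingEnd ℂ)) = (diagonal β')⁻¹ * Aᵀ * diagonal β' := by
    have h : Aᵀ * diagonal β' = diagonal β' * -(Λ.map (starRingEnd ℂ)) := by
      have hv : vecMulVec β' (fun _ : Fin s => (1 : ℂ)) * diagonal β' = vecMulVec β' β' := by
        ext i j
        simp [vecMulVec_apply]
      rw [← hAT, Matrix.sub_mul, hv, ← hM, Matrix.mul_neg]
      abel
    rw [Matrix.mul_assoc, h, nonsing_inv_mul_cancel_left _ _ hDdet]
  let r : Fin s → ℂ := fun j => (Real.sqrt (β j) : ℂ)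
  have hr0 : ∀ j, r j ≠ 0 := fun j =>
    Complex.ofReal_ne_zero.mpr (Real.sqrt_pos.mpr (hβpos j)).ne'
  have hrr : ∀ j, r j * r j = β' j := fun j => by
    rw [hβ']
    simp only [r, ← Complex.ofReal_mul, Real.mul_self_sqrt (hβpos j).le]
  have hrs : ∀ j, star (r j) = r j := fun j => Complex.conj_ofReal _
  have hβs : ∀ j, star (β' j) = β' j := fun j => by
    rw [hβ']
    exact Complex.conj_ofReal _
  obtain ⟨W, hW, hS⟩ := Matrix.exists_unitary_isSymm
      (diagonal r * A * diagonal r⁻¹) (-1) r (by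
    ext i j
    have h := congrArg star (congrFun (congrFun hM i) j)
    simp only [Matrix.add_apply, diagonal_mul, mul_diagonal, map_apply, transpose_apply,
      vecMulVec_apply, star_add, star_mul', hβs, RCLike.star_def, Complex.conj_conj] at h
    simp only [Matrix.add_apply, diagonal_mul, mul_diagonal, conjTranspose_apply, star_mul',
      hA, Matrix.sub_apply, vecMulVec_apply, star_sub, hβs, hrs, Pi.inv_apply, star_inv₀,
      Matrix.smul_apply, Pi.star_apply, smul_eq_mul, one_mul]
    simp only [RCLike.star_def]
    have hi := hr0 i
    have hj := hr0 j
    field_simp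
    simp only [← hrr, sq] at h ⊢
    linear_combination h)
  have hF : diagonal r⁻¹ * diagonal r = 1 := by
    rw [diagonal_mul_diagonal, ← diagonal_one]
    exact congrArg _ (funext fun j => inv_mul_cancel₀ (hr0 j))
  have hF' : diagonal r * diagonal r⁻¹ = 1 := mul_eq_one_comm.mp hF
  have hVW : (Wᴴ * diagonal r) * (diagonal r⁻¹ * W) = 1 := by
    rw [Matrix.mul_assoc, ← Matrix.mul_assoc (diagonal r), hF', Matrix.one_mul, hW]
  have hsim := Matrix.transpose_eq_of_isSymm_conj (M := A) hVW
    (by simpa only [Matrix.mul_assoc] using hS)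
  set X := diagonal r⁻¹ * W
  have hX : IsUnit X := IsUnit.of_mul_eq_one_right _ hVW
  have hXX : IsUnit (X * Xᵀ) := hX.mul ((isUnit_transpose X).mpr hX)
  refine ⟨by rw [hAT]; exact hfirst, ⟨X * Xᵀ * diagonal β', hXX.mul hD, ?_⟩, ?_⟩
  · rw [hfirst, hsim, Matrix.mul_inv_rev (X * Xᵀ) (diagonal β')]
    simp only [Matrix.mul_assoc]
  · rw [hfirst, ← charpoly_transpose A]
    obtain ⟨u, hu⟩ := hD
    rw [← hu, charpoly_units_conj']
end

section
/- Let Λ ∈ ℂ^{s×s} and β ∈ ℝˢ with β_j > 0 for all j, satisfying diag(β)·conj(Λ) + Λᵀ·diag(β) = β βᵀ. Then for every z ∈ ℂ with det(I_s − z·Λ) ≠ 0, the stability function satisfies 1 + z·βᵀ·(I_s − z·Λ)^{-1}·𝟙_s = det(I_s + z·conj(Λ)) / det(I_s − z·Λ). In particular, if μ₁,…,μ_s are the eigenvalues of Λ counted with multiplicity, this value equals Π_{i=1}^{s} (1 + conj(μ_i)·z)/(1 − μ_i·z). -/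
open Matrix

/-- The determinant of a rank-one update `A + z u vᵀ` of an invertible matrix. -/
theorem det_add_smul_vecMulVec {n K : Type*} [Fintype n] [DecidableEq n] [Field K]
    {A : Matrix n n K} (hA : A.det ≠ 0) (z : K) (u v : n → K) :
    (A + z • vecMulVec u v).det = A.det * (1 + z * (v ⬝ᵥ (A⁻¹ *ᵥ u))) := by
  rw [← smul_vecMulVec, vecMulVec_eq Unit, det_add_replicateCol_mul_replicateRow hA.isUnit,
    det_unique (n := Unit), Matrix.mul_assoc, ← replicateCol_mulVec, mulVec_smul]
  simp [replicateRow_mul_replicateCol_apply]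

/-- If the characteristic polynomial of `A` has roots `μ i`, then `det (1 - z A) = ∏ (1 - μ i z)`. -/
theorem det_one_sub_smul_eq_prod {n K : Type*} [Fintype n] [DecidableEq n] [Field K]
    {A : Matrix n n K} {μ : n → K}
    (h : A.charpoly = ∏ i, (Polynomial.X - Polynomial.C (μ i))) (z : K) :
    (1 - z • A).det = ∏ i, (1 - μ i * z) := by
  rcases eq_or_ne z 0 with rfl | hz
  · simp
  have hdet : (scalar n z⁻¹ - A).det = ∏ i, (z⁻¹ - μ i) := by
    rw [← eval_charpoly, h, Polynomial.eval_prod]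
    simp
  have hA : 1 - z • A = z • (scalar n z⁻¹ - A) := by
    ext i j; by_cases hij : i = j <;> simp [hij, hz, mul_sub]
  rw [hA, det_smul, hdet, Fintype.card, ← Finset.prod_const, ← Finset.prod_mul_distrib]
  refine Finset.prod_congr rfl fun i _ => ?_
  field_simp

/-- under `diag(β) conj(Λ) + Λᵀ diag(β) = β βᵀ` with positive `β`,
the stability function equals `det(I + z conj(Λ)) / det(I − zΛ)`; in terms of the
eigenvalues `μ i` of `Λ` (counted with multiplicity) it equals
`∏ i, (1 + conj(μ i) z)/(1 − μ i z)`. -/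
theorem stability_function_of_famous_m
    {s : ℕ} (Λ : Matrix (Fin s) (Fin s) ℂ) (β : Fin s → ℝ)
    (hβpos : ∀ j, 0 < β j)
    (β' : Fin s → ℂ) (hβ' : β' = fun j => (β j : ℂ))
    (hM : Matrix.diagonal β' * Λ.map (starRingEnd ℂ)
        + Λᵀ * Matrix.diagonal β' = vecMulVec β' β') :
    ∀ z : ℂ, (1 - z • Λ).det ≠ 0 →
      (1 + z * (β' ⬝ᵥ ((1 - z • Λ)⁻¹ *ᵥ fun _ : Fin s => (1:ℂ)))
          = (1 + z • Λ.map (starRingEnd ℂ)).det / (1 - z • Λ).det) ∧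
      ∀ μ : Fin s → ℂ,
        Λ.charpoly = ∏ i : Fin s, (Polynomial.X - Polynomial.C (μ i)) →
        1 + z * (β' ⬝ᵥ ((1 - z • Λ)⁻¹ *ᵥ fun _ : Fin s => (1:ℂ)))
          = ∏ i : Fin s, (1 + (starRingEnd ℂ) (μ i) * z) / (1 - μ i * z) := by
  have hβ0 : ∀ j, β' j ≠ 0 := fun j => by
    simp [hβ', (hβpos j).ne']
  intro z hz
  have hstab : 1 + z * (β' ⬝ᵥ ((1 - z • Λ)⁻¹ *ᵥ fun _ : Fin s => (1:ℂ)))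
      = (1 + z • Λ.map (starRingEnd ℂ)).det / (1 - z • Λ).det := by
    rw [eq_div_iff hz, mul_comm, ← det_add_smul_vecMulVec hz]
    have hD : (diagonal β').det ≠ 0 := by
      rw [det_diagonal]
      exact Finset.prod_ne_zero_iff.mpr fun j _ => hβ0 j
    have hint : diagonal β' * (1 - z • Λ + z • vecMulVec (fun _ => 1) β')
        = (1 + z • Λ.map (starRingEnd ℂ))ᵀ * diagonal β' := by
      ext i j
      have hij := congrFun (congrFun hM j) i
      simp only [Matrix.add_apply, diagonal_mul, mul_diagonal, transpose_apply, map_apply,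
        vecMulVec_apply] at hij
      simp only [Matrix.add_apply, Matrix.sub_apply, Matrix.smul_apply, diagonal_mul, mul_diagonal,
        transpose_apply, map_apply, vecMulVec_apply, smul_eq_mul]
      rcases eq_or_ne i j with rfl | hne
      · simp only [one_apply_eq]
        linear_combination -z * hij
      · simp only [one_apply_ne hne, one_apply_ne hne.symm]
        linear_combination -z * hij
    have hdet := congrArg det hint
    rw [det_mul, det_mul, det_transpose, mul_comm] at hdet
    exact mul_right_cancel₀ hD hdet
  refine ⟨hstab, fun μ hμ => ?_⟩
  have hconj : 1 + z • Λ.map (starRingEnd ℂ)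
      = (starRingEnd ℂ).mapMatrix (1 - (-(starRingEnd ℂ) z) • Λ) := by
    ext i j
    simp [one_apply, apply_ite (starRingEnd ℂ)]
  rw [hstab, hconj, ← RingHom.map_det, det_one_sub_smul_eq_prod hμ, det_one_sub_smul_eq_prod hμ,
    map_prod, ← Finset.prod_div_distrib]
  simp
end

section
/- Let V ∈ ℂ^{n×n} be invertible and λ₁,…,λ_n ∈ ℂ with Re(λ_i) < 0 for all i, and let b ∈ ℂⁿ. Choose the parameters μ_j = −1/conj(λ_j) for j = 1,…,n (so Re(μ_j) > 0 and 1 − μ_j·λ_i ≠ 0 for all i, j). Define R_j(z) = (1 + conj(μ_j)·z)/(1 − μ_j·z) and the iteration h₀ = b, h_j = V · diag(R_j(λ₁),…,R_j(λ_n)) · V^{-1} · h_{j−1}. Then h_n = 0. -/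
open Matrix

theorem inv_mulVec_conj_diagonal_mulVec {m K : Type*} [Fintype m] [DecidableEq m] [Field K]
    {V : Matrix m m K} (hV : IsUnit V) (d x : m → K) :
    V⁻¹ *ᵥ ((V * diagonal d * V⁻¹) *ᵥ x) = d * (V⁻¹ *ᵥ x) := by
  rw [mulVec_mulVec, Matrix.mul_assoc V,
    nonsing_inv_mul_cancel_left _ _ ((isUnit_iff_isUnit_det V).mp hV), ← mulVec_mulVec]
  ext i
  simp [mulVec_diagonal]

/-- with the parameter choice `μ_j = −1/conj(λ_j)` the iteration
terminates with `h_n = 0` after `n` steps. -/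
theorem adi_exact_after_n_steps
    {n : ℕ} (V : Matrix (Fin n) (Fin n) ℂ) (hV : IsUnit V)
    (lam : Fin n → ℂ) (hlam : ∀ i, (lam i).re < 0) (b : Fin n → ℂ)
    (μ : Fin n → ℂ) (hμ : ∀ j, μ j = -((starRingEnd ℂ) (lam j))⁻¹)
    (R : Fin n → ℂ → ℂ)
    (hR : ∀ j z, R j z = (1 + (starRingEnd ℂ) (μ j) * z) / (1 - μ j * z))
    (h : ℕ → Fin n → ℂ)
    (hh0 : h 0 = b)
    (hh : ∀ j : Fin n,
      h (j.val + 1) = (V * Matrix.diagonal (fun i => R j (lam i)) * V⁻¹) *ᵥ h j.val) :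
    h n = 0 := by
  have root (j : Fin n) : R j (lam j) = 0 := by
    have hne : lam j ≠ 0 := fun h0 => by simpa [h0] using hlam j
    simp [hR, hμ, hne]
  have vanish : ∀ k ≤ n, ∀ i : Fin n, i.val < k → (V⁻¹ *ᵥ h k) i = 0 := by
    intro k
    induction k with
    | zero => intro _ i hi; omega
    | succ k ih =>
      intro hk i hi
      rw [hh ⟨k, hk⟩, inv_mulVec_conj_diagonal_mulVec hV, Pi.mul_apply]
      rcases Nat.lt_succ_iff_lt_or_eq.mp hi with hlt | rfl
      · rw [ih (by omega) i hlt, mul_zero]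
      · rw [root i, zero_mul]
  have hzero : V⁻¹ *ᵥ h n = 0 := funext fun i => vanish n le_rfl i i.isLt
  rw [← one_mulVec (h n), ← mul_nonsing_inv V ((isUnit_iff_isUnit_det V).mp hV),
    ← mulVec_mulVec, hzero, mulVec_zero]
end

section
/- Let A ∈ ℝ^{n×n}, B ∈ ℝ^{m×m}, f ∈ ℝⁿ, g ∈ ℝᵐ, and for each step j = 1,…,N let Λ̂⁽ʲ⁾, Λ̌⁽ʲ⁾ ∈ ℂ^{s×s} and β⁽ʲ⁾ ∈ ℂˢ satisfy diag(β⁽ʲ⁾)·conj(Λ̌⁽ʲ⁾) + (Λ̂⁽ʲ⁾)ᵀ·diag(β⁽ʲ⁾) = β⁽ʲ⁾(β⁽ʲ⁾)ᵀ. Set ĥ₀ = f, ȟ₀ = −g, Y₀ = 0, and for each j suppose K̂_j, Ǩ_j satisfy K̂_j = [A ĥ_{j−1}, …, A ĥ_{j−1}] + A·K̂_j·(Λ̂⁽ʲ⁾)ᵀ and Ǩ_j = [−Bᵀ ȟ_{j−1}, …, −Bᵀ ȟ_{j−1}] − Bᵀ·Ǩ_j·(Λ̌⁽ʲ⁾)ᵀ;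 put Ĥ_j = [ĥ_{j−1}, …, ĥ_{j−1}] + K̂_j·(Λ̂⁽ʲ⁾)ᵀ, Ȟ_j = [ȟ_{j−1}, …, ȟ_{j−1}] + Ǩ_j·(Λ̌⁽ʲ⁾)ᵀ, and update Y_j = Y_{j−1} + Ĥ_j·diag(β⁽ʲ⁾)·Ȟ_jᴴ, ĥ_j = ĥ_{j−1} + K̂_j·β⁽ʲ⁾, ȟ_j = ȟ_{j−1} + Ǩ_j·conj(β⁽ʲ⁾). Then for every j = 1,…,N the rank-one Sylvester residual is preserved: A·Y_j − Y_j·B − f·gᵀ = ĥ_j·ȟ_jᴴ. -/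
open Matrix

/-- One Runge-Kutta step changes the Sylvester operator applied to the iterate exactly as it
changes the rank-one factor product. Here `K = A H` and `Lᴴ = -Gᴴ B` are the stage slopes. -/
theorem rank_one_residual_step {R n m s : Type*} [CommRing R] [StarRing R]
    [Fintype n] [Fintype m] [Fintype s] [DecidableEq s]
    (A : Matrix n n R) (B : Matrix m m R) (P Q : Matrix s s R) (b : s → R)
    (h : n → R) (k : m → R) (K H : Matrix n s R) (L G : Matrix m s R)
    (hM : diagonal b * Q.map (starRingEnd R) + Pᵀ * diagonal b = vecMulVec b b)
    (hK : K = A * H) (hL : Lᴴ = -(Gᴴ * B))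
    (hH : H = vecMulVec h 1 + K * Pᵀ) (hG : G = vecMulVec k 1 + L * Qᵀ) :
    A * (H * diagonal b * Gᴴ) - H * diagonal b * Gᴴ * B
      = vecMulVec (h + K *ᵥ b) (star (k + L *ᵥ star b)) - vecMulVec h (star k) := by
  have hGs : Gᴴ = vecMulVec 1 (star k) + Q.map (starRingEnd R) * Lᴴ := by
    rw [hG, conjTranspose_add, conjTranspose_mul, conjTranspose_vecMulVec, star_one]
    rfl
  have hstar : star (k + L *ᵥ star b) = star k + b ᵥ* Lᴴ := by
    rw [star_add, star_mulVec, star_star]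
  have hone : diagonal b *ᵥ (1 : s → R) = b := by
    ext i
    simp [mulVec, diagonal_dotProduct]
  have hone' : (1 : s → R) ᵥ* diagonal b = b := by
    ext i
    simp [vecMul_diagonal]
  have hML : K * (diagonal b * Q.map (starRingEnd R) + Pᵀ * diagonal b) * Lᴴ
      = K * vecMulVec b b * Lᴴ := by
    rw [hM]
  simp only [Matrix.mul_add, Matrix.add_mul, Matrix.mul_assoc, mul_vecMulVec,
    vecMulVec_mul] at hML
  have hA : A * (H * diagonal b * Gᴴ)
      = vecMulVec (K *ᵥ b) (star k) + K * (diagonal b * (Q.map (starRingEnd R) * Lᴴ)) := by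
    rw [← Matrix.mul_assoc, ← Matrix.mul_assoc, ← hK, hGs, Matrix.mul_assoc, Matrix.mul_add,
      Matrix.mul_add, mul_vecMulVec, mul_vecMulVec, hone]
  have hB : -(H * diagonal b * Gᴴ * B)
      = vecMulVec h (b ᵥ* Lᴴ) + K * (Pᵀ * (diagonal b * Lᴴ)) := by
    rw [Matrix.mul_assoc, ← Matrix.mul_neg, ← hL, hH, Matrix.add_mul, Matrix.add_mul,
      vecMulVec_mul, vecMulVec_mul, hone', Matrix.mul_assoc, Matrix.mul_assoc]
  rw [sub_eq_add_neg, hA, hB, hstar, add_add_add_comm, hML]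
  simp only [add_vecMulVec, vecMulVec_add]
  abel

/-- Runge-Kutta iterates for the Sylvester equation preserve the
rank-one residual: `A Y_j − Y_j B − f gᵀ = ĥ_j ȟ_jᴴ`, provided each step's
tableaus satisfy `diag(β) conj(Λ̌) + Λ̂ᵀ diag(β) = β βᵀ`. -/
theorem sylvester_rank_one_residual_invariant
    {n m s N : ℕ} (A : Matrix (Fin n) (Fin n) ℝ) (B : Matrix (Fin m) (Fin m) ℝ)
    (f : Fin n → ℝ) (g : Fin m → ℝ)
    (A' : Matrix (Fin n) (Fin n) ℂ) (hA' : A' = A.map Complex.ofReal)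
    (B' : Matrix (Fin m) (Fin m) ℂ) (hB' : B' = B.map Complex.ofReal)
    (f' : Fin n → ℂ) (hf' : f' = fun i => (f i : ℂ))
    (g' : Fin m → ℂ) (hg' : g' = fun i => (g i : ℂ))
    (Λhat Λcheck : ℕ → Matrix (Fin s) (Fin s) ℂ) (β : ℕ → Fin s → ℂ)
    (hM : ∀ j, 1 ≤ j → j ≤ N →
      Matrix.diagonal (β j) * (Λcheck j).map (starRingEnd ℂ)
        + (Λhat j)ᵀ * Matrix.diagonal (β j) = vecMulVec (β j) (β j))
    (hhat : ℕ → Fin n → ℂ) (hcheck : ℕ → Fin m → ℂ)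
    (Khat Hhat : ℕ → Matrix (Fin n) (Fin s) ℂ)
    (Kcheck Hcheck : ℕ → Matrix (Fin m) (Fin s) ℂ)
    (Y : ℕ → Matrix (Fin n) (Fin m) ℂ)
    (hhat0 : hhat 0 = f') (hcheck0 : hcheck 0 = -g') (hY0 : Y 0 = 0)
    (hKhat : ∀ j, j < N →
      Khat (j+1) = (Matrix.of fun p (_ : Fin s) => (A' *ᵥ hhat j) p)
        + A' * Khat (j+1) * (Λhat (j+1))ᵀ)
    (hKcheck : ∀ j, j < N →
      Kcheck (j+1) = (Matrix.of fun p (_ : Fin s) => (-(B'ᵀ *ᵥ hcheck j)) p)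
        - B'ᵀ * Kcheck (j+1) * (Λcheck (j+1))ᵀ)
    (hHhat : ∀ j, j < N →
      Hhat (j+1) = (Matrix.of fun p (_ : Fin s) => hhat j p)
        + Khat (j+1) * (Λhat (j+1))ᵀ)
    (hHcheck : ∀ j, j < N →
      Hcheck (j+1) = (Matrix.of fun p (_ : Fin s) => hcheck j p)
        + Kcheck (j+1) * (Λcheck (j+1))ᵀ)
    (hYs : ∀ j, j < N →
      Y (j+1) = Y j + Hhat (j+1) * Matrix.diagonal (β (j+1)) * (Hcheck (j+1))ᴴ)
    (hhats : ∀ j, j < N → hhat (j+1) = hhat j + Khat (j+1) *ᵥ β (j+1))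
    (hchecks : ∀ j, j < N →
      hcheck (j+1) = hcheck j + Kcheck (j+1) *ᵥ (star (β (j+1)))) :
    ∀ j, 1 ≤ j → j ≤ N →
      A' * Y j - Y j * B' - vecMulVec f' g'
        = vecMulVec (hhat j) (star (hcheck j)) := by
  have key : ∀ j, j ≤ N → A' * Y j - Y j * B' - vecMulVec f' g'
      = vecMulVec (hhat j) (star (hcheck j)) := by
    intro j
    induction j with
    | zero =>
      intro _
      have hg : star g' = g' := by
        ext i
        simp [hg']
      rw [hY0, hhat0, hcheck0, star_neg, hg]
      simp [vecMulVec_neg]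
    | succ j ih =>
      intro hj
      have hjN : j < N := hj
      have hconst : ∀ {p : ℕ} (v : Fin p → ℂ),
          (Matrix.of fun i (_ : Fin s) => v i) = vecMulVec v 1 := by
        intro p v
        ext i l
        simp [vecMulVec_apply]
      have hH := hHhat j hjN
      have hG := hHcheck j hjN
      rw [hconst] at hH hG
      have hK : Khat (j+1) = A' * Hhat (j+1) := by
        rw [hH, Matrix.mul_add, mul_vecMulVec, ← hconst, ← Matrix.mul_assoc]
        exact hKhat j hjN
      have hL : Kcheck (j+1) = -(B'ᵀ * Hcheck (j+1)) := by
        rw [hG, Matrix.mul_add, mul_vecMulVec, ← Matrix.mul_assoc, neg_add, ← neg_vecMulVec,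
          ← hconst, ← sub_eq_add_neg]
        exact hKcheck j hjN
      have hB : B'ᵀᴴ = B' := by
        ext i l
        simp [hB']
      have hLs : (Kcheck (j+1))ᴴ = -((Hcheck (j+1))ᴴ * B') := by
        rw [hL, conjTranspose_neg, conjTranspose_mul, hB]
      have hstep := rank_one_residual_step A' B' _ _ (β (j+1)) (hhat j) (hcheck j)
        _ _ _ _ (hM (j+1) (Nat.succ_pos j) hj) hK hLs hH hG
      rw [hhats j hjN, hchecks j hjN, hYs j hjN, Matrix.mul_add, Matrix.add_mul,
        ← sub_add_cancel (vecMulVec (hhat j + _) _) (vecMulVec (hhat j) (star (hcheck j))),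
        ← hstep, ← ih hjN.le]
      abel
  exact fun j _ hj => key j hj
end

section
/- Let Λ̂, Λ̌ ∈ ℂ^{s×s} and β ∈ ℂˢ with β_i ≠ 0 for all i, satisfying diag(β)·conj(Λ̌) + Λ̂ᵀ·diag(β) = β βᵀ. Then diag(β)·conj(Λ̌)·diag(β)^{-1} = (𝟙_s·βᵀ − Λ̂)ᵀ; consequently Λ̂ − 𝟙_s·βᵀ and −conj(Λ̌) have the same characteristic polynomial, and likewise Λ̌ − 𝟙_s·βᴴ and −conj(Λ̂) have the same characteristic polynomial. -/
open Matrix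

/-- A matrix conjugate by an invertible diagonal matrix to the transpose of `N` has the
characteristic polynomial of `N`. -/
theorem charpoly_eq_of_diagonal_mul_eq_transpose_mul {n K : Type*} [Fintype n] [DecidableEq n]
    [Field K] {M N : Matrix n n K} {d : n → K} (hd : ∀ i, d i ≠ 0)
    (h : Matrix.diagonal d * M = Nᵀ * Matrix.diagonal d) : M.charpoly = N.charpoly := by
  obtain ⟨u, hu⟩ : IsUnit (Matrix.diagonal d) :=
    Matrix.isUnit_diagonal.mpr (Pi.isUnit_iff.mpr fun i => (hd i).isUnit)
  rw [← hu] at h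
  rw [← Matrix.charpoly_transpose N, ← Matrix.charpoly_units_conj u M, h, mul_assoc,
    ← Matrix.coe_units_inv, Units.mul_inv, mul_one]

/-- if `diag(β) conj(Λ̌) + Λ̂ᵀ diag(β) = β βᵀ` with all `β i ≠ 0`,
then `diag(β) conj(Λ̌) diag(β)⁻¹ = (𝟙 βᵀ − Λ̂)ᵀ`; consequently `Λ̂ − 𝟙 βᵀ` and
`−conj(Λ̌)` have the same characteristic polynomial, and likewise
`Λ̌ − 𝟙 βᴴ` and `−conj(Λ̂)`. -/
theorem sylvester_famous_m_similarity
    {s : ℕ} (Λhat Λcheck : Matrix (Fin s) (Fin s) ℂ) (β : Fin s → ℂ)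
    (hβ : ∀ i, β i ≠ 0)
    (hM : Matrix.diagonal β * Λcheck.map (starRingEnd ℂ)
        + Λhatᵀ * Matrix.diagonal β = vecMulVec β β) :
    Matrix.diagonal β * Λcheck.map (starRingEnd ℂ) * (Matrix.diagonal β)⁻¹
        = (vecMulVec (fun _ : Fin s => (1:ℂ)) β - Λhat)ᵀ ∧
      (Λhat - vecMulVec (fun _ : Fin s => (1:ℂ)) β).charpoly
        = (-(Λcheck.map (starRingEnd ℂ))).charpoly ∧
      (Λcheck - vecMulVec (fun _ : Fin s => (1:ℂ))
          (fun j => (starRingEnd ℂ) (β j))).charpoly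
        = (-(Λhat.map (starRingEnd ℂ))).charpoly := by
  have hentry (i j : Fin s) :
      β i * (starRingEnd ℂ) (Λcheck i j) + Λhat j i * β j = β i * β j := by
    simpa [vecMulVec_apply] using congrFun (congrFun hM i) j
  have hconj : Matrix.diagonal β * Λcheck.map (starRingEnd ℂ)
      = (vecMulVec (fun _ : Fin s => (1:ℂ)) β - Λhat)ᵀ * Matrix.diagonal β := by
    ext i j
    simp only [diagonal_mul, mul_diagonal, map_apply, transpose_apply, Matrix.sub_apply,
      vecMulVec_apply]
    linear_combination hentry i j
  refine ⟨?_, ?_, ?_⟩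
  · have hdet : IsUnit (Matrix.diagonal β).det := by
      simpa [det_diagonal, Finset.prod_ne_zero_iff] using hβ
    rw [hconj, mul_assoc, mul_nonsing_inv _ hdet, mul_one]
  · refine (charpoly_eq_of_diagonal_mul_eq_transpose_mul hβ ?_).symm
    rw [mul_neg, hconj, ← neg_mul, ← transpose_neg, neg_sub]
  · refine charpoly_eq_of_diagonal_mul_eq_transpose_mul
      (d := fun i => (starRingEnd ℂ) (β i)) (fun i => by simpa using hβ i) ?_
    ext i j
    have h := congrArg (starRingEnd ℂ) (hentry i j)
    simp only [map_add, map_mul, Complex.conj_conj] at h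
    simp only [diagonal_mul, mul_diagonal, map_apply, transpose_apply, Matrix.sub_apply,
      Matrix.neg_apply, vecMulVec_apply]
    linear_combination h
end

section
/- Let Λ̂, Λ̌ ∈ ℂ^{s×s} and β ∈ ℂˢ with β_i ≠ 0 for all i, satisfying diag(β)·conj(Λ̌) + Λ̂ᵀ·diag(β) = β βᵀ. Then for every z ∈ ℂ with det(I_s − z·Λ̂) ≠ 0 one has 1 + z·βᵀ·(I_s − z·Λ̂)^{-1}·𝟙_s = det(I_s + z·conj(Λ̌)) / det(I_s − z·Λ̂), and for every z ∈ ℂ with det(I_s − z·Λ̌) ≠ 0 one has 1 + z·(conj(β))ᵀ·(I_s − z·Λ̌)^{-1}·𝟙_s = det(I_s + z·conj(Λ̂)) / det(I_s − z·Λ̌). -/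
open Matrix

/-- The matrix determinant lemma in terms of `dotProduct` and `mulVec`. -/
theorem det_add_vecMulVec {n K : Type*} [Fintype n] [DecidableEq n] [Field K]
    {A : Matrix n n K} (hA : A.det ≠ 0) (u v : n → K) :
    (A + vecMulVec u v).det = A.det * (1 + v ⬝ᵥ (A⁻¹ *ᵥ u)) := by
  rw [vecMulVec_eq Unit, det_add_replicateCol_mul_replicateRow (isUnit_iff_ne_zero.mpr hA),
    Matrix.mul_assoc, ← replicateCol_mulVec, det_one_add_mul_comm (replicateRow Unit v),
    det_one_add_replicateCol_mul_replicateRow]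

/-- If `diag(β) C + Aᵀ diag(β) = β βᵀ` with all `β i ≠ 0`, then
`1 + z βᵀ (I − z A)⁻¹ 𝟙 = det(I + z C) / det(I − z A)`. -/
theorem one_add_mul_dotProduct_inv_mulVec_one_eq_det_div {n K : Type*} [Fintype n]
    [DecidableEq n] [Field K] {A C : Matrix n n K} {β : n → K} (hβ : ∀ i, β i ≠ 0)
    (h : diagonal β * C + Aᵀ * diagonal β = vecMulVec β β)
    {z : K} (hz : (1 - z • A).det ≠ 0) :
    1 + z * (β ⬝ᵥ ((1 - z • A)⁻¹ *ᵥ fun _ : n => (1 : K)))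
      = (1 + z • C).det / (1 - z • A).det := by
  have hD : (diagonal β).det ≠ 0 := by
    rw [det_diagonal]
    exact Finset.prod_ne_zero_iff.mpr fun i _ => hβ i
  have hββ : vecMulVec β β = vecMulVec β (fun _ : n => (1 : K)) * diagonal β := by
    ext i j
    simp [vecMulVec_apply, mul_diagonal]
  have hfac : diagonal β * (1 + z • C)
      = (1 - z • A + vecMulVec (fun _ : n => (1 : K)) (z • β))ᵀ * diagonal β := by
    have hT : (1 - z • A + vecMulVec (fun _ : n => (1 : K)) (z • β))ᵀ
        = 1 - z • Aᵀ + z • vecMulVec β (fun _ : n => (1 : K)) := by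
      ext i j
      simp [vecMulVec_apply, one_apply, eq_comm]
    rw [hT, Matrix.add_mul, Matrix.sub_mul, Matrix.smul_mul, Matrix.smul_mul, ← hββ, ← h,
      Matrix.mul_add, Matrix.mul_smul, Matrix.one_mul, Matrix.mul_one, smul_add]
    abel
  have hdet := congrArg det hfac
  rw [det_mul, det_mul, det_transpose, mul_comm, det_add_vecMulVec hz, smul_dotProduct,
    smul_eq_mul] at hdet
  rw [eq_div_iff hz, mul_comm]
  exact (mul_right_cancel₀ hD hdet).symm

/-- under `diag(β) conj(Λ̌) + Λ̂ᵀ diag(β) = β βᵀ` with all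
`β i ≠ 0`, the two stability functions satisfy
`1 + z βᵀ (I − z Λ̂)⁻¹ 𝟙 = det(I + z conj(Λ̌))/det(I − z Λ̂)` and
`1 + z conj(β)ᵀ (I − z Λ̌)⁻¹ 𝟙 = det(I + z conj(Λ̂))/det(I − z Λ̌)`. -/
theorem sylvester_stability_functions_det_formulas
    {s : ℕ} (Λhat Λcheck : Matrix (Fin s) (Fin s) ℂ) (β : Fin s → ℂ)
    (hβ : ∀ i, β i ≠ 0)
    (hM : Matrix.diagonal β * Λcheck.map (starRingEnd ℂ)
        + Λhatᵀ * Matrix.diagonal β = vecMulVec β β) :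
    (∀ z : ℂ, (1 - z • Λhat).det ≠ 0 →
      1 + z * (β ⬝ᵥ ((1 - z • Λhat)⁻¹ *ᵥ fun _ : Fin s => (1:ℂ)))
        = (1 + z • Λcheck.map (starRingEnd ℂ)).det / (1 - z • Λhat).det) ∧
    ∀ z : ℂ, (1 - z • Λcheck).det ≠ 0 →
      1 + z * ((fun j => (starRingEnd ℂ) (β j)) ⬝ᵥ
          ((1 - z • Λcheck)⁻¹ *ᵥ fun _ : Fin s => (1:ℂ)))
        = (1 + z • Λhat.map (starRingEnd ℂ)).det / (1 - z • Λcheck).det := by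
  refine ⟨fun z hz => one_add_mul_dotProduct_inv_mulVec_one_eq_det_div hβ hM hz,
    fun z hz => one_add_mul_dotProduct_inv_mulVec_one_eq_det_div
      (fun i => (map_ne_zero (starRingEnd ℂ)).mpr (hβ i)) ?_ hz⟩
  ext i j
  have hij := congrArg (starRingEnd ℂ) (congrFun (congrFun hM j) i)
  simp only [Matrix.add_apply, diagonal_mul, mul_diagonal, transpose_apply, map_apply,
    vecMulVec_apply, map_add, map_mul, Complex.conj_conj] at hij ⊢
  linear_combination hij
end
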